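/- arXiv:1510.02448 — 2 statements merged into one kernel-verified Lean document; each statement's English description precedes it below -/
import Mathlib

section
/- Let μ be a probability measure on [0,∞) with ∫ t dμ(t) = 1, and suppose that for every y ≥ 0 the function t ↦ log(1+t·y) is μ-integrable. Then the function g : [0,∞) → ℝ defined by g(y) = log(1+y) − ∫ log(1+t·y) dμ(t) is monotone nondecreasing on [0,∞). -/
open MeasureTheory

/-- The concave function `t ↦ log (1 + t * b) - log (1 + t * a)` lies below its tangent line
at `t = 1`. -/
theorem log_one_add_mul_sub_le_tangent {a b t : ℝ} (ha : 0 ≤ a) (hab : a ≤ b) (ht : 0 ≤ t) :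
    Real.log (1 + t * b) - Real.log (1 + t * a) ≤
      Real.log (1 + b) - Real.log (1 + a) + (b - a) / ((1 + a) * (1 + b)) * (t - 1) := by
  have hb : 0 ≤ b := ha.trans hab
  have h1 : 0 < 1 + t * b := by positivity
  have h2 : 0 < 1 + t * a := by positivity
  have h3 : 0 < 1 + a := by positivity
  have h4 : 0 < 1 + b := by positivity
  have hlog := Real.log_le_sub_one_of_pos
    (show 0 < (1 + t * b) * (1 + a) / ((1 + t * a) * (1 + b)) by positivity)
  rw [Real.log_div (by positivity) (by positivity), Real.log_mul h1.ne' h3.ne',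
    Real.log_mul h2.ne' h4.ne'] at hlog
  have hgap : (b - a) / ((1 + a) * (1 + b)) * (t - 1) -
      ((1 + t * b) * (1 + a) / ((1 + t * a) * (1 + b)) - 1) =
      (b - a) * a * (t - 1) ^ 2 / ((1 + a) * (1 + b) * (1 + t * a)) := by
    field_simp
    ring
  have hnonneg : 0 ≤ (b - a) * a * (t - 1) ^ 2 / ((1 + a) * (1 + b) * (1 + t * a)) := by
    have := sub_nonneg.2 hab
    positivity
  linarith

/-- Let `μ` be a probability measure on `[0,∞)` with `∫ t dμ(t) = 1`, such that for every
`y ≥ 0` the function `t ↦ log(1+t·y)` is `μ`-integrable. Then the rate-gap function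
`g(y) = log(1+y) − ∫ log(1+t·y) dμ(t)` is monotone nondecreasing on `[0,∞)`. -/
theorem stmt_2 (μ : Measure ℝ) [IsProbabilityMeasure μ]
    (hsupp : ∀ᵐ t ∂μ, 0 ≤ t) (hmean : ∫ t, t ∂μ = 1)
    (hint : ∀ y : ℝ, 0 ≤ y → Integrable (fun t => Real.log (1 + t * y)) μ) :
    MonotoneOn (fun y : ℝ => Real.log (1 + y) - ∫ t, Real.log (1 + t * y) ∂μ)
      (Set.Ici (0 : ℝ)) := by
  intro a ha b hb hab
  have hid : Integrable (fun t : ℝ => t) μ :=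
    Integrable.of_integral_ne_zero (by rw [hmean]; exact one_ne_zero)
  have hlin : Integrable (fun t : ℝ => (b - a) / ((1 + a) * (1 + b)) * (t - 1)) μ :=
    (hid.sub (integrable_const 1)).const_mul _
  have hmono := integral_mono_ae ((hint b hb).sub (hint a ha))
    ((integrable_const (Real.log (1 + b) - Real.log (1 + a))).add hlin)
    (hsupp.mono fun t ht => log_one_add_mul_sub_le_tangent ha hab ht)
  simp only [Pi.sub_apply, Pi.add_apply] at hmono
  rw [integral_sub (hint b hb) (hint a ha), integral_add (integrable_const _) hlin,
    integral_const_mul, integral_sub hid (integrable_const 1), hmean] at hmono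
  simp only [integral_const, probReal_univ, one_smul, sub_self, mul_zero, add_zero] at hmono
  dsimp only
  linarith
end

section
/- The Gaussian gap function g_G(y) = log(1+y) − ∫_0^∞ log(1+t·y)·e^{−t} dt tends to the Euler–Mascheroni constant γ as y → ∞, i.e., lim_{y→∞} g_G(y) = γ. -/
open MeasureTheory Filter

/-- The integral representation `Γ'(1) = ∫_0^∞ log t · e^{-t} dt`, evaluated. -/
lemma integral_log_mul_exp_neg :
    ∫ t in Set.Ioi (0 : ℝ), Real.log t * Real.exp (-t) = -Real.eulerMascheroniConstant := by
  have hG : HasDerivAt Complex.GammaIntegral (-(Real.eulerMascheroniConstant : ℂ)) 1 := by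
    refine Complex.hasDerivAt_Gamma_one.congr_of_eventuallyEq ?_
    have : {s : ℂ | 0 < s.re} ∈ nhds (1 : ℂ) :=
      (isOpen_lt continuous_const Complex.continuous_re).mem_nhds (by simp)
    filter_upwards [this] with s hs
    exact (Complex.Gamma_eq_integral hs).symm
  have h := (Complex.hasDerivAt_GammaIntegral (s := 1) (by simp)).unique hG
  simp only [sub_self, Complex.cpow_zero, one_mul, ← Complex.ofReal_mul] at h
  rw [integral_complex_ofReal] at h
  exact_mod_cast h

lemma integrableOn_log_mul_exp_neg :
    IntegrableOn (fun t : ℝ => Real.log t * Real.exp (-t)) (Set.Ioi 0) := by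
  by_contra h
  have h0 := integral_log_mul_exp_neg
  rw [integral_undef h] at h0
  linarith [Real.one_half_lt_eulerMascheroniConstant]

lemma integrableOn_log_one_add_mul_mul_exp_neg {y : ℝ} (hy : 0 ≤ y) :
    IntegrableOn (fun t : ℝ => Real.log (1 + t * y) * Real.exp (-t)) (Set.Ioi 0) := by
  have hΓ : IntegrableOn (fun t : ℝ => y * (Real.exp (-t) * t ^ ((2 : ℝ) - 1))) (Set.Ioi 0) :=
    (Real.GammaIntegral_convergent two_pos).const_mul y
  refine Integrable.mono' hΓ (by fun_prop) ?_
  filter_upwards [ae_restrict_mem measurableSet_Ioi] with t (ht : 0 < t)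
  have hty : 0 ≤ t * y := by positivity
  rw [Real.norm_of_nonneg (mul_nonneg (Real.log_nonneg (by linarith)) (Real.exp_pos _).le)]
  have hlog := Real.log_le_sub_one_of_pos (show 0 < 1 + t * y by positivity)
  have hpow : t ^ ((2 : ℝ) - 1) = t := by norm_num
  rw [hpow]
  nlinarith [Real.exp_pos (-t)]

lemma abs_log_one_add_sub_log_one_add_mul_le {t y : ℝ} (ht : 0 < t) (hy : 0 ≤ y) :
    |Real.log (1 + y) - Real.log (1 + t * y)| ≤ |Real.log t| := by
  have hty : 0 < 1 + t * y := by positivity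
  have hy1 : 0 < 1 + y := by positivity
  rcases le_total t 1 with h | h
  · have h1 : Real.log (1 + t * y) ≤ Real.log (1 + y) := Real.log_le_log hty (by nlinarith)
    have h2 : Real.log (t * (1 + y)) ≤ Real.log (1 + t * y) :=
      Real.log_le_log (by positivity) (by nlinarith)
    rw [Real.log_mul ht.ne' hy1.ne'] at h2
    rw [abs_of_nonneg (by linarith)]
    linarith [neg_abs_le (Real.log t)]
  · have h1 : Real.log (1 + y) ≤ Real.log (1 + t * y) := Real.log_le_log hy1 (by nlinarith)
    have h2 : Real.log (1 + t * y) ≤ Real.log (t * (1 + y)) :=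
      Real.log_le_log hty (by nlinarith)
    rw [Real.log_mul ht.ne' hy1.ne'] at h2
    rw [abs_of_nonpos (by linarith)]
    linarith [le_abs_self (Real.log t)]

lemma tendsto_log_one_add_sub_log_one_add_mul {t : ℝ} (ht : 0 < t) :
    Tendsto (fun y : ℝ => Real.log (1 + y) - Real.log (1 + t * y)) atTop
      (nhds (-Real.log t)) := by
  have hinv : Tendsto (fun y : ℝ => y⁻¹) atTop (nhds 0) := tendsto_inv_atTop_zero
  have hlim (c : ℝ) (hc : 0 < c) :
      Tendsto (fun y : ℝ => Real.log (y⁻¹ + c)) atTop (nhds (Real.log c)) := by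
    have := (hinv.add_const c).log (by simpa using hc.ne')
    simpa using this
  have h := (hlim 1 one_pos).sub (hlim t ht)
  rw [Real.log_one, zero_sub] at h
  refine h.congr' ?_
  filter_upwards [eventually_gt_atTop 0] with y hy
  have hfactor (c : ℝ) (hc : 0 < c) :
      Real.log (1 + c * y) = Real.log y + Real.log (y⁻¹ + c) := by
    rw [← Real.log_mul hy.ne' (by positivity)]
    congr 1
    field_simp
  have h1 := hfactor 1 one_pos
  rw [one_mul] at h1
  rw [h1, hfactor t ht]
  ring

/-- The Gaussian gap function `g_G(y) = log(1+y) − ∫_0^∞ log(1+t·y)·e^{−t} dt` tends to the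
Euler–Mascheroni constant `γ` as `y → ∞`. -/
theorem stmt_4 :
    Tendsto
      (fun y : ℝ =>
        Real.log (1 + y) - ∫ t in Set.Ioi (0 : ℝ), Real.log (1 + t * y) * Real.exp (-t))
      atTop (nhds Real.eulerMascheroniConstant) := by
  have hlim : Tendsto
      (fun y : ℝ => ∫ t in Set.Ioi (0 : ℝ),
        (Real.log (1 + y) - Real.log (1 + t * y)) * Real.exp (-t))
      atTop (nhds (∫ t in Set.Ioi (0 : ℝ), -Real.log t * Real.exp (-t))) := by
    refine tendsto_integral_filter_of_dominated_convergence _ ?_ ?_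
      integrableOn_log_mul_exp_neg.norm ?_
    · exact .of_forall fun y => by fun_prop
    · filter_upwards [eventually_ge_atTop 0] with y hy
      filter_upwards [ae_restrict_mem measurableSet_Ioi] with t ht
      rw [norm_mul, norm_mul]
      exact mul_le_mul_of_nonneg_right (abs_log_one_add_sub_log_one_add_mul_le ht hy)
        (norm_nonneg _)
    · filter_upwards [ae_restrict_mem measurableSet_Ioi] with t ht
      exact (tendsto_log_one_add_sub_log_one_add_mul ht).mul_const _
  simp only [neg_mul, integral_neg, integral_log_mul_exp_neg, neg_neg] at hlim
  refine hlim.congr' ?_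
  filter_upwards [eventually_ge_atTop 0] with y hy
  have hexp : IntegrableOn (fun t : ℝ => Real.log (1 + y) * Real.exp (-t)) (Set.Ioi 0) :=
    (integrableOn_exp_neg_Ioi 0).const_mul _
  simp only [sub_mul]
  rw [integral_sub hexp (integrableOn_log_one_add_mul_mul_exp_neg hy), integral_const_mul,
    integral_exp_neg_Ioi_zero, mul_one]
end
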